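/- Let ψ₀(x₁,x₂) = (1 − x₁² − x₂²)·(6x₁² + 3x₂² − x₂⁴ − 1) on ℝ². Then the critical points of ψ₀ in the open unit disc are exactly the five points (0,0), (√(7/12), 0), (−√(7/12), 0), (0, √(2/3)), (0, −√(2/3)). Moreover: ψ₀(0,0) = −1 and the Hessian of ψ₀ at (0,0) is the diagonal matrix diag(14, 8), so (0,0) is a nondegenerate local minimum; ψ₀(±√(7/12), 0) = 25/24 and the Hessian there is diag(−28, −5/2), so these are nondegenerate local maxima; ψ₀(0, ±√(2/3)) = 5/27 and the Hessian there is diag(26/9, −32/3), so these are nondegenerate saddle points. -/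

import Mathlib

open MeasureTheory Set Filter Topology

noncomputable section

/-- First partial derivative (in the direction `x₁`) of a function on `ℝ × ℝ`. -/
def pd1 {E : Type*} [NormedAddCommGroup E] [NormedSpace ℝ E] (u : ℝ × ℝ → E) (x : ℝ × ℝ) : E :=
  fderiv ℝ u x (1, 0)

/-- Second partial derivative (in the direction `x₂`) of a function on `ℝ × ℝ`. -/
def pd2 {E : Type*} [NormedAddCommGroup E] [NormedSpace ℝ E] (u : ℝ × ℝ → E) (x : ℝ × ℝ) : E :=
  fderiv ℝ u x (0, 1)

/-- The Laplacian on `ℝ × ℝ`. -/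
def lap (ψ : ℝ × ℝ → ℝ) (x : ℝ × ℝ) : ℝ := pd1 (pd1 ψ) x + pd2 (pd2 ψ) x

/-- Test functions for the Dirichlet variational problems on `Ω`:
nonzero smooth compactly supported functions with support in `Ω`. -/
def IsTestFun (Ω : Set (ℝ × ℝ)) (u : ℝ × ℝ → ℂ) : Prop :=
  ContDiff ℝ (⊤ : ℕ∞) u ∧ HasCompactSupport u ∧ tsupport u ⊆ Ω ∧ u ≠ 0

/-- Rayleigh quotient of the spin-`σ` (`σ = -1` : spin-down, `σ = 1` : spin-up)
Dirichlet Pauli operator at the test function `u`. -/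
def pauliRayleigh (σ : ℝ) (h : ℝ) (A : ℝ × ℝ → ℝ × ℝ) (B : ℝ × ℝ → ℝ) (Ω : Set (ℝ × ℝ))
    (u : ℝ × ℝ → ℂ) : ℝ :=
  ((∫ x in Ω, (‖(h : ℂ) * pd1 u x - Complex.I * ((A x).1 : ℂ) * u x‖ ^ 2
      + ‖(h : ℂ) * pd2 u x - Complex.I * ((A x).2 : ℂ) * u x‖ ^ 2))
    + σ * (h * ∫ x in Ω, B x * ‖u x‖ ^ 2)) / ∫ x in Ω, ‖u x‖ ^ 2

/-- The ground state energy `λ₋^D(h,A,B,Ω)` of the spin-down Dirichlet Pauli operator. -/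
def lambdaMinusD (h : ℝ) (A : ℝ × ℝ → ℝ × ℝ) (B : ℝ × ℝ → ℝ) (Ω : Set (ℝ × ℝ)) : ℝ :=
  sInf (pauliRayleigh (-1) h A B Ω '' {u | IsTestFun Ω u})

/-- The ground state energy `λ₊^D(h,A,B,Ω)` of the spin-up Dirichlet Pauli operator. -/
def lambdaPlusD (h : ℝ) (A : ℝ × ℝ → ℝ × ℝ) (B : ℝ × ℝ → ℝ) (Ω : Set (ℝ × ℝ)) : ℝ :=
  sInf (pauliRayleigh 1 h A B Ω '' {u | IsTestFun Ω u})

/-- The ground state energy `Λ^D(h,A,B,Ω)` of the full Dirichlet Pauli operator. -/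
def LambdaD (h : ℝ) (A : ℝ × ℝ → ℝ × ℝ) (B : ℝ × ℝ → ℝ) (Ω : Set (ℝ × ℝ)) : ℝ :=
  min (lambdaMinusD h A B Ω) (lambdaPlusD h A B Ω)

/-- The canonical vector potential `∇⊥ψ = (−∂₂ψ, ∂₁ψ)`. -/
def perpGrad (ψ : ℝ × ℝ → ℝ) (x : ℝ × ℝ) : ℝ × ℝ := (-(pd2 ψ x), pd1 ψ x)

/-- `ψ` is the scalar potential of `B` on `Ω`: `ψ ∈ C⁰(closure Ω) ∩ C²(Ω)`,
`Δψ = B` in `Ω` and `ψ = 0` on `∂Ω`. -/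
structure IsScalarPotential (Ω : Set (ℝ × ℝ)) (B : ℝ × ℝ → ℝ) (ψ : ℝ × ℝ → ℝ) : Prop where
  contOn : ContinuousOn ψ (closure Ω)
  c2 : ContDiffOn ℝ 2 ψ Ω
  lap_eq : ∀ x ∈ Ω, lap ψ x = B x
  bdry : ∀ x ∈ frontier Ω, ψ x = 0

/-- `A` is a continuous vector potential for `B` on `Ω`: `∂₁A₂ − ∂₂A₁ = B`. -/
def IsVectorPotential (Ω : Set (ℝ × ℝ)) (B : ℝ × ℝ → ℝ) (A : ℝ × ℝ → ℝ × ℝ) : Prop :=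
  ContinuousOn A Ω ∧ ∀ x ∈ Ω, pd1 (fun y => (A y).2) x - pd2 (fun y => (A y).1) x = B x

/-- `γ` is a regular curve of class `C^{2,α}` on the parameter set `s`. -/
def C2HolderOn (α : ℝ) (γ : ℝ → ℝ × ℝ) (s : Set ℝ) : Prop :=
  ContDiffOn ℝ 2 γ s ∧
  (∃ C : ℝ, ∀ x ∈ s, ∀ y ∈ s,
      ‖derivWithin (derivWithin γ s) s x - derivWithin (derivWithin γ s) s y‖ ≤ C * |x - y| ^ α) ∧
  ∀ x ∈ s, derivWithin γ s x ≠ 0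

/-- Near `p`, the set `Γ` is a regular curve of class `C^{2,α}`. -/
def IsLocallyC2CurveAt (α : ℝ) (Γ : Set (ℝ × ℝ)) (p : ℝ × ℝ) : Prop :=
  ∃ ε > 0, ∃ γ : ℝ → ℝ × ℝ, C2HolderOn α γ (Icc (-1) 1) ∧ γ 0 = p ∧
    Γ ∩ Metric.ball p ε = γ '' Ioo (-1) 1 ∩ Metric.ball p ε

/-- `Γ` is (locally) a regular curve of class `C^{2,α}`. -/
def IsC2HolderSet (α : ℝ) (Γ : Set (ℝ × ℝ)) : Prop := ∀ p ∈ Γ, IsLocallyC2CurveAt α Γ p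

/-- `Ω` has a corner at `p` formed by two `C^{2,α}` arcs, of aperture less than `π`
(near `p`, `Ω` is contained in a strictly convex open cone with vertex `p`). -/
def HasConvexCornerAt (Ω : Set (ℝ × ℝ)) (α : ℝ) (p : ℝ × ℝ) : Prop :=
  ∃ ε > 0, (∃ γ₁ γ₂ : ℝ → ℝ × ℝ, C2HolderOn α γ₁ (Icc 0 1) ∧ C2HolderOn α γ₂ (Icc 0 1) ∧
      γ₁ 0 = p ∧ γ₂ 0 = p ∧
      frontier Ω ∩ Metric.ball p ε = (γ₁ '' Ico 0 1 ∪ γ₂ '' Ico 0 1) ∩ Metric.ball p ε) ∧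
    ∃ w : ℝ × ℝ, ∃ c > 0, ∀ x ∈ Ω ∩ Metric.ball p ε,
      c * ‖x - p‖ ≤ (x - p).1 * w.1 + (x - p).2 * w.2

/-- `Ω` has a continuous boundary which is piecewise of class `C^{2,α}` for some `α > 0`,
with at most finitely many corners, each of aperture less than `π`. -/
def HasPiecewiseC2Boundary (Ω : Set (ℝ × ℝ)) : Prop :=
  ∃ α > 0, ∃ S : Finset (ℝ × ℝ), ↑S ⊆ frontier Ω ∧
    (∀ p ∈ frontier Ω \ (S : Set (ℝ × ℝ)), IsLocallyC2CurveAt α (frontier Ω) p) ∧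
    ∀ p ∈ S, HasConvexCornerAt Ω α p

/-- Assumption (R): `Ω` is bounded and open with continuous, piecewise `C^{2,α}` boundary
having finitely many corners of aperture `< π`, and `B` extends continuously to `closure Ω`. -/
structure AssumptionR (Ω : Set (ℝ × ℝ)) (B : ℝ × ℝ → ℝ) : Prop where
  isOpen : IsOpen Ω
  bounded : Bornology.IsBounded Ω
  bdryReg : HasPiecewiseC2Boundary Ω
  fieldCont : ContinuousOn B (closure Ω)

/-- The oscillation of `ψ` over `Ω`. -/
def osc (ψ : ℝ × ℝ → ℝ) (Ω : Set (ℝ × ℝ)) : ℝ := sSup (ψ '' Ω) - sInf (ψ '' Ω)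

/-- The region enclosed by `Γ`: the union of the bounded connected components of `Γᶜ`. -/
def curveInterior (Γ : Set (ℝ × ℝ)) : Set (ℝ × ℝ) :=
  {x | x ∉ Γ ∧ Bornology.IsBounded (connectedComponentIn Γᶜ x)}

/-- `Γ` is a simple closed curve of class `C^{2,α}`. -/
def IsC2ClosedCurve (α : ℝ) (Γ : Set (ℝ × ℝ)) : Prop :=
  ∃ γ : ℝ → ℝ × ℝ, Function.Periodic γ 1 ∧ C2HolderOn α γ (Icc 0 1) ∧
    InjOn γ (Ico 0 1) ∧ Γ = γ '' Icc 0 1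

/-- The ground state energy `λ^D(Ω)` of the Dirichlet Laplacian on `Ω`. -/
def dirichletGSE (Ω : Set (ℝ × ℝ)) : ℝ :=
  sInf ((fun u : ℝ × ℝ → ℝ =>
      (∫ x in Ω, (pd1 u x ^ 2 + pd2 u x ^ 2)) / ∫ x in Ω, u x ^ 2) ''
    {u | ContDiff ℝ (⊤ : ℕ∞) u ∧ HasCompactSupport u ∧ tsupport u ⊆ Ω ∧ u ≠ 0})

/-- The open disc of radius `R` centred at the origin (with the Euclidean distance). -/
def disc (R : ℝ) : Set (ℝ × ℝ) := {y : ℝ × ℝ | y.1 ^ 2 + y.2 ^ 2 < R ^ 2}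

end

theorem pd1_eq_of_hasDerivAt {u : ℝ × ℝ → ℝ} {x : ℝ × ℝ} {d : ℝ} (hu : DifferentiableAt ℝ u x)
    (h : HasDerivAt (fun t => u (t, x.2)) d x.1) : pd1 u x = d := by
  have hline : HasDerivAt (fun t : ℝ => (t, x.2)) ((1 : ℝ), (0 : ℝ)) x.1 :=
    (hasDerivAt_id x.1).prodMk (hasDerivAt_const x.1 x.2)
  exact (HasFDerivAt.comp_hasDerivAt x.1 (f := fun t : ℝ => (t, x.2)) hu.hasFDerivAt hline).unique h

theorem pd2_eq_of_hasDerivAt {u : ℝ × ℝ → ℝ} {x : ℝ × ℝ} {d : ℝ} (hu : DifferentiableAt ℝ u x)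
    (h : HasDerivAt (fun t => u (x.1, t)) d x.2) : pd2 u x = d := by
  have hline : HasDerivAt (fun t : ℝ => (x.1, t)) ((0 : ℝ), (1 : ℝ)) x.2 :=
    (hasDerivAt_const x.2 x.1).prodMk (hasDerivAt_id x.2)
  exact (HasFDerivAt.comp_hasDerivAt x.2 (f := fun t : ℝ => (x.1, t)) hu.hasFDerivAt hline).unique h

theorem fderiv_eq_zero_iff_pd {u : ℝ × ℝ → ℝ} {x : ℝ × ℝ} :
    fderiv ℝ u x = 0 ↔ pd1 u x = 0 ∧ pd2 u x = 0 := by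
  refine ⟨fun h => by simp [pd1, pd2, h], fun ⟨h1, h2⟩ => ?_⟩
  ext <;> simpa [pd1, pd2] using by assumption

/-- The potential `(1 − x₁² − x₂²)(6x₁² + 3x₂² − x₂⁴ − 1)`. -/
def fivePointPotential (x : ℝ × ℝ) : ℝ :=
  (1 - x.1 ^ 2 - x.2 ^ 2) * (6 * x.1 ^ 2 + 3 * x.2 ^ 2 - x.2 ^ 4 - 1)

theorem hasDerivAt_poly_six (a b c d e f g t : ℝ) :
    HasDerivAt (fun t : ℝ => a + b * t + c * t ^ 2 + d * t ^ 3 + e * t ^ 4 + f * t ^ 5 + g * t ^ 6)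
      (b + 2 * c * t + 3 * d * t ^ 2 + 4 * e * t ^ 3 + 5 * f * t ^ 4 + 6 * g * t ^ 5) t := by
  have h := (((((((hasDerivAt_id' t).const_mul b).const_add a).add
    ((hasDerivAt_pow 2 t).const_mul c)).add ((hasDerivAt_pow 3 t).const_mul d)).add
    ((hasDerivAt_pow 4 t).const_mul e)).add ((hasDerivAt_pow 5 t).const_mul f)).add
    ((hasDerivAt_pow 6 t).const_mul g)
  refine h.congr_deriv ?_
  norm_num
  ring

theorem pd1_fivePointPotential :
    pd1 fivePointPotential =
      fun x => 2 * x.1 * (7 - 12 * x.1 ^ 2 - 9 * x.2 ^ 2 + x.2 ^ 4) := by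
  funext ⟨x, y⟩
  refine pd1_eq_of_hasDerivAt (by unfold fivePointPotential; fun_prop) ?_
  convert hasDerivAt_poly_six ((1 - y ^ 2) * (3 * y ^ 2 - y ^ 4 - 1)) 0
    (7 - 9 * y ^ 2 + y ^ 4) 0 (-6) 0 0 x using 1
  · funext t
    simp only [fivePointPotential]
    ring
  · ring

theorem pd2_fivePointPotential :
    pd2 fivePointPotential =
      fun x => 2 * x.2 * (4 - 9 * x.1 ^ 2 - 8 * x.2 ^ 2 + 3 * x.2 ^ 4
        + 2 * x.1 ^ 2 * x.2 ^ 2) := by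
  funext ⟨x, y⟩
  refine pd2_eq_of_hasDerivAt (by unfold fivePointPotential; fun_prop) ?_
  convert hasDerivAt_poly_six ((1 - x ^ 2) * (6 * x ^ 2 - 1)) 0 (4 - 9 * x ^ 2) 0
    (x ^ 2 - 4) 0 1 y using 1
  · funext t
    simp only [fivePointPotential]
    ring
  · ring

theorem pd1_pd1_fivePointPotential (x y : ℝ) :
    pd1 (pd1 fivePointPotential) (x, y) = 14 - 72 * x ^ 2 - 18 * y ^ 2 + 2 * y ^ 4 := by
  rw [pd1_fivePointPotential]
  refine pd1_eq_of_hasDerivAt (by fun_prop) ?_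
  convert hasDerivAt_poly_six 0 (14 - 18 * y ^ 2 + 2 * y ^ 4) 0 (-24) 0 0 0 x using 1
  · funext t
    ring
  · ring

theorem pd2_pd2_fivePointPotential (x y : ℝ) :
    pd2 (pd2 fivePointPotential) (x, y) =
      8 - 18 * x ^ 2 - 48 * y ^ 2 + 30 * y ^ 4 + 12 * x ^ 2 * y ^ 2 := by
  rw [pd2_fivePointPotential]
  refine pd2_eq_of_hasDerivAt (by fun_prop) ?_
  convert hasDerivAt_poly_six 0 (8 - 18 * x ^ 2) 0 (4 * x ^ 2 - 16) 0 6 0 y using 1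
  · funext t
    ring
  · ring

theorem pd2_pd1_fivePointPotential (x y : ℝ) :
    pd2 (pd1 fivePointPotential) (x, y) = -36 * x * y + 8 * x * y ^ 3 := by
  rw [pd1_fivePointPotential]
  refine pd2_eq_of_hasDerivAt (by fun_prop) ?_
  convert hasDerivAt_poly_six (2 * x * (7 - 12 * x ^ 2)) 0 (-18 * x) 0 (2 * x) 0 0 y using 1
  · funext t
    ring
  · ring

theorem pd1_pd2_fivePointPotential (x y : ℝ) :
    pd1 (pd2 fivePointPotential) (x, y) = -36 * x * y + 8 * x * y ^ 3 := by
  rw [pd2_fivePointPotential]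
  refine pd1_eq_of_hasDerivAt (by fun_prop) ?_
  convert hasDerivAt_poly_six (2 * y * (4 - 8 * y ^ 2 + 3 * y ^ 4)) 0
    (-18 * y + 4 * y ^ 3) 0 0 0 0 x using 1
  · funext t
    ring
  · ring

theorem eq_sqrt_or_eq_neg_sqrt_iff {c s : ℝ} (hc : 0 ≤ c) :
    (s = Real.sqrt c ∨ s = -Real.sqrt c) ↔ s ^ 2 = c := by
  rw [← sq_eq_sq_iff_eq_or_eq_neg, Real.sq_sqrt hc]

theorem gradient_fivePointPotential_eq_zero_iff {x y : ℝ} (hxy : x ^ 2 + y ^ 2 < 1) :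
    fderiv ℝ fivePointPotential (x, y) = 0 ↔
      (x = 0 ∧ y = 0) ∨ (x ^ 2 = 7 / 12 ∧ y = 0) ∨ (x = 0 ∧ y ^ 2 = 2 / 3) := by
  rw [fderiv_eq_zero_iff_pd, pd1_fivePointPotential, pd2_fivePointPotential]
  dsimp only
  constructor
  · rintro ⟨h1, h2⟩
    by_cases hx : x = 0 <;> by_cases hy : y = 0
    · exact Or.inl ⟨hx, hy⟩
    · refine Or.inr (Or.inr ⟨hx, ?_⟩)
      subst hx
      have h := (mul_eq_zero.mp h2).resolve_left (by simpa using hy)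
      have hfac : (3 * y ^ 2 - 2) * (y ^ 2 - 2) = 0 := by linear_combination h
      rcases mul_eq_zero.mp hfac with h | h <;> linarith
    · refine Or.inr (Or.inl ⟨?_, hy⟩)
      subst hy
      have h := (mul_eq_zero.mp h1).resolve_left (by simpa using hx)
      linarith
    · exfalso
      have ha := (mul_eq_zero.mp h1).resolve_left (by simpa using hx)
      have hb := (mul_eq_zero.mp h2).resolve_left (by simpa using hy)
      have hcubic : 2 * (y ^ 2) ^ 3 + 9 * (y ^ 2) ^ 2 - y ^ 2 - 15 = 0 := by
        linear_combination 12 * hb - (9 - 2 * y ^ 2) * ha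
      have hy0 : 0 ≤ y ^ 2 := sq_nonneg y
      have hy1 : y ^ 2 ≤ 1 := by nlinarith [sq_nonneg x]
      have hsq : (y ^ 2) ^ 2 ≤ 1 := pow_le_one₀ hy0 hy1
      have hcube : (y ^ 2) ^ 3 ≤ 1 := pow_le_one₀ hy0 hy1
      linarith
  · rintro (⟨rfl, rfl⟩ | ⟨hx, rfl⟩ | ⟨rfl, hy⟩)
    · simp
    · exact ⟨by rw [hx]; ring, by ring⟩
    · exact ⟨by ring, by linear_combination (2 * y) * (3 * y ^ 2 - 6) * hy⟩

theorem isLocalMin_fivePointPotential_zero : IsLocalMin fivePointPotential (0, 0) := by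
  have h1 : ∀ᶠ p : ℝ × ℝ in 𝓝 (0, 0), p.1 ^ 2 < 1 / 10 :=
    ContinuousAt.eventually_lt (by fun_prop) continuousAt_const (by norm_num)
  have h2 : ∀ᶠ p : ℝ × ℝ in 𝓝 (0, 0), p.2 ^ 2 < 1 / 10 :=
    ContinuousAt.eventually_lt (by fun_prop) continuousAt_const (by norm_num)
  filter_upwards [h1, h2] with ⟨x, y⟩ ha hb
  simp only [fivePointPotential] at *
  have ha0 := sq_nonneg x
  have hb0 := sq_nonneg y
  rw [show y ^ 4 = (y ^ 2) ^ 2 by ring]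
  generalize x ^ 2 = a at *
  generalize y ^ 2 = b at *
  have hs : (a + b) * (6 * a + 3 * b - b ^ 2) ≤ (a + b) * (9 / 10) :=
    mul_le_mul_of_nonneg_left (by nlinarith) (by linarith)
  nlinarith

theorem isLocalMax_fivePointPotential {s : ℝ} (hs : s ^ 2 = 7 / 12) :
    IsLocalMax fivePointPotential (s, 0) := by
  have h1 : ∀ᶠ p : ℝ × ℝ in 𝓝 (s, 0), p.1 ^ 2 < 7 / 12 + 1 / 20 :=
    ContinuousAt.eventually_lt (by fun_prop) continuousAt_const (by norm_num [hs])
  have h2 : ∀ᶠ p : ℝ × ℝ in 𝓝 (s, 0), 7 / 12 - 1 / 20 < p.1 ^ 2 :=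
    ContinuousAt.eventually_lt continuousAt_const (by fun_prop) (by norm_num [hs])
  have h3 : ∀ᶠ p : ℝ × ℝ in 𝓝 (s, 0), p.2 ^ 2 < 1 / 10 :=
    ContinuousAt.eventually_lt (by fun_prop) continuousAt_const (by norm_num)
  filter_upwards [h1, h2, h3] with ⟨x, y⟩ ha ha' hb
  simp only [fivePointPotential, hs] at *
  have hb0 := sq_nonneg y
  rw [show y ^ 4 = (y ^ 2) ^ 2 by ring]
  obtain ⟨u, hu⟩ : ∃ u, x ^ 2 = 7 / 12 + u := ⟨x ^ 2 - 7 / 12, by ring⟩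
  rw [hu] at ha ha' ⊢
  generalize y ^ 2 = b at *
  have hpos : 0 ≤ b * (5 / 4 + 9 * u + 3 * b + 5 / 12 * b - u * b - b ^ 2) :=
    mul_nonneg hb0 (by nlinarith [mul_nonneg hb0 (by linarith : 0 ≤ 41 / 12 - u - b)])
  nlinarith [sq_nonneg u]

theorem not_isLocalMin_fivePointPotential {s : ℝ} (hs : s ^ 2 = 2 / 3) :
    ¬IsLocalMin fivePointPotential (0, s) := by
  intro h
  have hc : Tendsto (fun t : ℝ => ((0 : ℝ), s * (1 - t))) (𝓝[>] 0) (𝓝 (0, s)) :=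
    ((by fun_prop : Continuous fun t : ℝ => ((0 : ℝ), s * (1 - t))).tendsto' 0 _
      (by simp)).mono_left nhdsWithin_le_nhds
  obtain ⟨t, ht, ht0, ht1⟩ :=
    ((hc.eventually h).and (Ioo_mem_nhdsGT (zero_lt_one' ℝ))).exists
  simp only [fivePointPotential] at ht
  rw [show (s * (1 - t)) ^ 4 = (s ^ 2) ^ 2 * ((1 - t) ^ 2) ^ 2 by ring,
    show s ^ 4 = (s ^ 2) ^ 2 by ring, mul_pow, hs] at ht
  obtain ⟨v, hv⟩ : ∃ v, (1 - t) ^ 2 = 1 - v := ⟨1 - (1 - t) ^ 2, by ring⟩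
  have hv0 : 0 < v := by nlinarith
  rw [hv] at ht
  nlinarith [pow_pos hv0 2, pow_pos hv0 3]

theorem not_isLocalMax_fivePointPotential {s : ℝ} (hs : s ^ 2 = 2 / 3) :
    ¬IsLocalMax fivePointPotential (0, s) := by
  intro h
  have hc : Tendsto (fun t : ℝ => (t, s)) (𝓝[>] 0) (𝓝 (0, s)) :=
    ((by fun_prop : Continuous fun t : ℝ => (t, s)).tendsto' 0 _ rfl).mono_left
      nhdsWithin_le_nhds
  obtain ⟨t, ht, ht0, ht1⟩ :=
    ((hc.eventually h).and (Ioo_mem_nhdsGT (show (0 : ℝ) < 1 / 4 by norm_num))).exists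
  simp only [fivePointPotential] at ht
  rw [show s ^ 4 = (s ^ 2) ^ 2 by ring, hs] at ht
  have hpos : 0 < t ^ 2 * (13 / 9 - 6 * t ^ 2) := mul_pos (pow_pos ht0 2) (by nlinarith)
  nlinarith

/-- Section 7, second example: the critical points of
`ψ₀ = (1−r²)(6x₁²+3x₂²−x₂⁴−1)` in the open unit disc are exactly five, with the stated
values, Hessians and nature (minimum, maxima, saddles). -/
theorem second_example_critical_points (ψ : ℝ × ℝ → ℝ)
    (hψ : ψ = fun x => (1 - x.1 ^ 2 - x.2 ^ 2) * (6 * x.1 ^ 2 + 3 * x.2 ^ 2 - x.2 ^ 4 - 1)) :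
    {x ∈ disc 1 | fderiv ℝ ψ x = 0} =
      {((0 : ℝ), (0 : ℝ)), (Real.sqrt (7 / 12), 0), (-Real.sqrt (7 / 12), 0),
        (0, Real.sqrt (2 / 3)), (0, -Real.sqrt (2 / 3))} ∧
    (ψ (0, 0) = -1 ∧ pd1 (pd1 ψ) (0, 0) = 14 ∧ pd2 (pd2 ψ) (0, 0) = 8 ∧
      pd1 (pd2 ψ) (0, 0) = 0 ∧ pd2 (pd1 ψ) (0, 0) = 0 ∧ IsLocalMin ψ (0, 0)) ∧
    (∀ s : ℝ, s = Real.sqrt (7 / 12) ∨ s = -Real.sqrt (7 / 12) →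
      ψ (s, 0) = 25 / 24 ∧ pd1 (pd1 ψ) (s, 0) = -28 ∧ pd2 (pd2 ψ) (s, 0) = -(5 / 2) ∧
      pd1 (pd2 ψ) (s, 0) = 0 ∧ pd2 (pd1 ψ) (s, 0) = 0 ∧ IsLocalMax ψ (s, 0)) ∧
    (∀ s : ℝ, s = Real.sqrt (2 / 3) ∨ s = -Real.sqrt (2 / 3) →
      ψ (0, s) = 5 / 27 ∧ pd1 (pd1 ψ) (0, s) = 26 / 9 ∧ pd2 (pd2 ψ) (0, s) = -(32 / 3) ∧
      pd1 (pd2 ψ) (0, s) = 0 ∧ pd2 (pd1 ψ) (0, s) = 0 ∧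
      ¬IsLocalMin ψ (0, s) ∧ ¬IsLocalMax ψ (0, s)) := by
  obtain rfl : ψ = fivePointPotential := hψ
  have hmem : ∀ c : ℝ, 0 ≤ c → ∀ s : ℝ, (s = Real.sqrt c ∨ s = -Real.sqrt c) ↔ s ^ 2 = c :=
    fun c hc s => eq_sqrt_or_eq_neg_sqrt_iff hc
  refine ⟨?_, ⟨by norm_num [fivePointPotential], by norm_num [pd1_pd1_fivePointPotential],
    by norm_num [pd2_pd2_fivePointPotential], by norm_num [pd1_pd2_fivePointPotential],
    by norm_num [pd2_pd1_fivePointPotential], isLocalMin_fivePointPotential_zero⟩, ?_, ?_⟩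
  · ext ⟨x, y⟩
    have hx := hmem (7 / 12) (by norm_num) x
    have hy := hmem (2 / 3) (by norm_num) y
    simp only [mem_ofPred_eq, disc, mem_insert_iff, mem_singleton_iff, Prod.mk.injEq, one_pow]
    constructor
    · rintro ⟨hd, hg⟩
      have := (gradient_fivePointPotential_eq_zero_iff hd).mp hg
      tauto
    · intro h
      have hpts : (x = 0 ∧ y = 0) ∨ (x ^ 2 = 7 / 12 ∧ y = 0) ∨ (x = 0 ∧ y ^ 2 = 2 / 3) := by
        tauto
      have hd : x ^ 2 + y ^ 2 < 1 := by
        rcases hpts with ⟨rfl, rfl⟩ | ⟨h, rfl⟩ | ⟨rfl, h⟩ <;> norm_num [*]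
      exact ⟨hd, (gradient_fivePointPotential_eq_zero_iff hd).mpr hpts⟩
  · intro s hs
    rw [hmem _ (by norm_num)] at hs
    exact ⟨by norm_num [fivePointPotential, hs], by norm_num [pd1_pd1_fivePointPotential, hs],
      by norm_num [pd2_pd2_fivePointPotential, hs], by norm_num [pd1_pd2_fivePointPotential],
      by norm_num [pd2_pd1_fivePointPotential], isLocalMax_fivePointPotential hs⟩
  · intro s hs
    rw [hmem _ (by norm_num)] at hs
    have hs4 : s ^ 4 = 4 / 9 := by rw [show s ^ 4 = (s ^ 2) ^ 2 by ring, hs]; norm_num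
    exact ⟨by norm_num [fivePointPotential, hs, hs4],
      by norm_num [pd1_pd1_fivePointPotential, hs, hs4],
      by norm_num [pd2_pd2_fivePointPotential, hs, hs4],
      by norm_num [pd1_pd2_fivePointPotential], by norm_num [pd2_pd1_fivePointPotential],
      not_isLocalMin_fivePointPotential hs, not_isLocalMax_fivePointPotential hs⟩
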